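/- arXiv:2603.26626 — 10 statements merged into one kernel-verified Lean document; each statement's English description precedes it below -/
import Mathlib

section
/- Let G be a group and let H₁ and H₂ be subgroups of G, each satisfying property (*). Then the subgroup H₁ ⊔ H₂ of G generated by H₁ and H₂ also satisfies property (*). -/
/-- A subgroup `H` of `G` satisfies property (*) if for every `g ∈ G`,
whenever `g` commutes with the commutator `g⁻¹h⁻¹gh` for every `h ∈ H`,
then `g` commutes with every element of `H`. -/
def StarProp {G : Type*} [Group G] (H : Subgroup G) : Prop :=
  ∀ g : G, (∀ h ∈ H, Commute g (g⁻¹ * h⁻¹ * g * h)) → ∀ h ∈ H, Commute g h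

theorem star_prop_sup {G : Type*} [Group G] (H₁ H₂ : Subgroup G)
    (h1 : StarProp H₁) (h2 : StarProp H₂) : StarProp (H₁ ⊔ H₂) := by
  intro g hg
  have hle₁ : H₁ ≤ Subgroup.centralizer {g} := fun h hh =>
    Subgroup.mem_centralizer_singleton_iff.2
      (h1 g (fun k hk => hg k (Subgroup.mem_sup_left hk)) h hh).symm
  have hle₂ : H₂ ≤ Subgroup.centralizer {g} := fun h hh =>
    Subgroup.mem_centralizer_singleton_iff.2
      (h2 g (fun k hk => hg k (Subgroup.mem_sup_right hk)) h hh).symm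
  intro h hh
  exact (Subgroup.mem_centralizer_singleton_iff.1 (sup_le hle₁ hle₂ hh)).symm
end

section
/- Every group G contains a greatest subgroup satisfying property (*): there exists a subgroup B of G such that B satisfies (*) and every subgroup of G satisfying (*) is contained in B. -/
/-- The supremum of any family of subgroups with property (*) has property (*). -/
theorem starProp_sSup {G : Type*} [Group G] {S : Set (Subgroup G)} (hS : ∀ H ∈ S, StarProp H) :
    StarProp (sSup S) := by
  intro g hg h hh
  have hle : sSup S ≤ Subgroup.centralizer {g} := sSup_le fun H hH k hk =>
    Subgroup.mem_centralizer_singleton_iff.2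
      (hS H hH g (fun x hx => hg x (le_sSup hH hx)) k hk).symm
  exact (Subgroup.mem_centralizer_singleton_iff.1 (hle hh)).symm

theorem exists_greatest_star_subgroup (G : Type*) [Group G] :
    ∃ B : Subgroup G, StarProp B ∧ ∀ H : Subgroup G, StarProp H → H ≤ B :=
  ⟨sSup {H | StarProp H}, starProp_sSup fun _ hH => hH, fun _ hH => le_sSup hH⟩
end

section
/- Let G be a group. Define a descending sequence of subgroups of G by A₀ = G and A_{i+1} = {g ∈ A_i : g commutes with every element of Z₂(A_i)}, where Z₂(A_i) := {a ∈ A_i : for every b ∈ A_i, the commutator a⁻¹b⁻¹ab lies in the center of A_i} is the second center of A_i. Then every subgroup H of G satisfying property (*) is contained in A_i for every i ∈ ℕ. -/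
/-- The second centre of a subgroup `A` of `G`, viewed as a subset of `G`:
those `a ∈ A` such that for every `b ∈ A` the commutator `a⁻¹b⁻¹ab` lies in the
centre of `A`, i.e. commutes with every element of `A`. -/
def SecondCenterSet {G : Type*} [Group G] (A : Subgroup G) : Set G :=
  {a : G | a ∈ A ∧ ∀ b ∈ A, (a⁻¹ * b⁻¹ * a * b ∈ A ∧
    ∀ c ∈ A, Commute (a⁻¹ * b⁻¹ * a * b) c)}

/-- The descending sequence `A₀ = G`, `A_{i+1} = {g ∈ A_i : g commutes with every
element of Z₂(A_i)}`. -/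
def Aseq {G : Type*} [Group G] : ℕ → Subgroup G
  | 0 => ⊤
  | i + 1 => Aseq i ⊓ Subgroup.centralizer (SecondCenterSet (Aseq i))

theorem star_subgroup_le_Aseq {G : Type*} [Group G] (H : Subgroup G)
    (hH : StarProp H) : ∀ i : ℕ, H ≤ Aseq i := by
  intro i
  induction i with
  | zero => exact le_top
  | succ i ih =>
    refine le_inf ih fun h hh => Subgroup.mem_centralizer_iff.mpr fun z hz => ?_
    exact hH z (fun k hk => ((hz.2 k (ih hk)).2 z hz.1).symm) h hh
end

section
/- Let 𝔤 be a Lie algebra over a field K and let 𝔞 and 𝔟 be Lie ideals of 𝔤, each satisfying property (**). Then the Lie ideal 𝔞 + 𝔟 also satisfies property (**). -/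
/-- A Lie ideal `a` of `L` satisfies property (**) if for every `x ∈ L`,
whenever `⁅x, ⁅x, y⁆⁆ = 0` for all `y ∈ a`, then `⁅x, y⁆ = 0` for all `y ∈ a`. -/
def StarStarProp {K L : Type*} [Field K] [LieRing L] [LieAlgebra K L]
    (a : LieIdeal K L) : Prop :=
  ∀ x : L, (∀ y ∈ a, ⁅x, ⁅x, y⁆⁆ = 0) → ∀ y ∈ a, ⁅x, y⁆ = 0

theorem starStar_sup {K L : Type*} [Field K] [LieRing L] [LieAlgebra K L]
    (a b : LieIdeal K L) (ha : StarStarProp a) (hb : StarStarProp b) :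
    StarStarProp (a ⊔ b) := by
  intro x hx y hy
  obtain ⟨u, hu, v, hv, rfl⟩ := (LieSubmodule.mem_sup a b y).mp hy
  have hau : ⁅x, u⁆ = 0 := ha x (fun z hz => hx z (le_sup_left (a := a) hz)) u hu
  have hbv : ⁅x, v⁆ = 0 := hb x (fun z hz => hx z (le_sup_right (b := b) hz)) v hv
  rw [lie_add, hau, hbv, add_zero]
end

section
/- Let 𝔤 be a finite-dimensional Lie algebra over a field K. Then 𝔤 contains a greatest Lie ideal satisfying property (**): there exists a Lie ideal B of 𝔤 such that B satisfies (**) and every Lie ideal of 𝔤 satisfying (**) is contained in B; moreover, the center of 𝔤 is contained in B. -/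
theorem starStarProp_sSup {K L : Type*} [Field K] [LieRing L] [LieAlgebra K L]
    {S : Set (LieIdeal K L)} (hS : ∀ a ∈ S, StarStarProp a) : StarStarProp (sSup S) := by
  intro x hx y hy
  have hle : (sSup S).toSubmodule ≤ LinearMap.ker (LieAlgebra.ad K L x) := by
    rw [LieSubmodule.sSup_toSubmodule]
    refine sSup_le ?_
    rintro _ ⟨a, ha, rfl⟩ z hz
    exact LinearMap.mem_ker.2 (hS a ha x (fun w hw => hx w (le_sSup ha hw)) z hz)
  exact LinearMap.mem_ker.1 (hle hy)

theorem starStarProp_center (K L : Type*) [Field K] [LieRing L] [LieAlgebra K L] :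
    StarStarProp (LieAlgebra.center K L) :=
  fun x _ y hy => (LieModule.mem_maxTrivSubmodule K L L y).1 hy x

theorem exists_greatest_starStar_ideal (K L : Type*) [Field K] [LieRing L]
    [LieAlgebra K L] [FiniteDimensional K L] :
    ∃ B : LieIdeal K L, StarStarProp B ∧
      (∀ a : LieIdeal K L, StarStarProp a → a ≤ B) ∧
      (∀ z : L, (∀ x : L, ⁅z, x⁆ = 0) → z ∈ B) := by
  refine ⟨sSup {a | StarStarProp a}, starStarProp_sSup fun _ ha => ha,
    fun a ha => le_sSup ha, fun z hz => ?_⟩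
  refine le_sSup (a := LieAlgebra.center K L) (starStarProp_center K L) ?_
  refine (LieModule.mem_maxTrivSubmodule K L L z).2 fun x => ?_
  rw [← lie_skew, hz x, neg_zero]
end

section
/- Let 𝔤₁ and 𝔤₂ be Lie algebras over a field K. Suppose B₁ is a Lie ideal of 𝔤₁ satisfying property (**) and containing every Lie ideal of 𝔤₁ satisfying (**), and suppose B₂ is a Lie ideal of 𝔤₂ with the analogous property. Then the product B₁ × B₂ is a Lie ideal of the product Lie algebra 𝔤₁ × 𝔤₂ which satisfies property (**) and contains every Lie ideal of 𝔤₁ × 𝔤₂ satisfying (**). -/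
/-- The product of two Lie rings, with componentwise bracket. -/
instance prodLieRing {L₁ L₂ : Type*} [LieRing L₁] [LieRing L₂] : LieRing (L₁ × L₂) where
  bracket x y := (⁅x.1, y.1⁆, ⁅x.2, y.2⁆)
  add_lie x y z := Prod.ext (add_lie x.1 y.1 z.1) (add_lie x.2 y.2 z.2)
  lie_add x y z := Prod.ext (lie_add x.1 y.1 z.1) (lie_add x.2 y.2 z.2)
  lie_self x := Prod.ext (lie_self x.1) (lie_self x.2)
  leibniz_lie x y z := Prod.ext (leibniz_lie x.1 y.1 z.1) (leibniz_lie x.2 y.2 z.2)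

/-- The product of two Lie algebras. -/
instance prodLieAlgebra {K L₁ L₂ : Type*} [CommRing K] [LieRing L₁] [LieRing L₂]
    [LieAlgebra K L₁] [LieAlgebra K L₂] : LieAlgebra K (L₁ × L₂) where
  lie_smul c x y := Prod.ext (lie_smul c x.1 y.1) (lie_smul c x.2 y.2)

/-- The image of an ideal with property (**) under a split surjection `f` whose section `g`
intertwines the brackets has property (**). -/
theorem StarStarProp.map {K L M : Type*} [Field K] [LieRing L] [LieAlgebra K L]
    [LieRing M] [LieAlgebra K M] {a : LieIdeal K L} (ha : StarStarProp a)
    (f : L →ₗ⁅K⁆ M) (g : M → L) (hfg : Function.LeftInverse f g) (hg : g 0 = 0)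
    (hlie : ∀ x y, ⁅g x, y⁆ = g ⁅x, f y⁆) : StarStarProp (a.map f) := by
  intro x hx y hy
  obtain ⟨⟨z, hz⟩, rfl⟩ := LieIdeal.mem_map_of_surjective hfg.surjective hy
  have hgx : ⁅g x, z⁆ = 0 := by
    refine ha (g x) (fun w hw => ?_) z hz
    rw [hlie x w, hlie, hfg, hx (f w) (LieIdeal.mem_map hw), hg]
  rw [hlie, ← hg] at hgx
  exact hfg.injective hgx

theorem starStar_prod {K L₁ L₂ : Type*} [Field K] [LieRing L₁] [LieRing L₂]
    [LieAlgebra K L₁] [LieAlgebra K L₂]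
    (B₁ : LieIdeal K L₁) (hB₁ : StarStarProp B₁)
    (hB₁max : ∀ a : LieIdeal K L₁, StarStarProp a → a ≤ B₁)
    (B₂ : LieIdeal K L₂) (hB₂ : StarStarProp B₂)
    (hB₂max : ∀ a : LieIdeal K L₂, StarStarProp a → a ≤ B₂) :
    ∃ B : LieIdeal K (L₁ × L₂),
      (∀ z : L₁ × L₂, z ∈ B ↔ z.1 ∈ B₁ ∧ z.2 ∈ B₂) ∧
      StarStarProp B ∧
      ∀ a : LieIdeal K (L₁ × L₂), StarStarProp a → a ≤ B := by
  let p₁ : L₁ × L₂ →ₗ⁅K⁆ L₁ := { LinearMap.fst K L₁ L₂ with map_lie' := rfl }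
  let p₂ : L₁ × L₂ →ₗ⁅K⁆ L₂ := { LinearMap.snd K L₁ L₂ with map_lie' := rfl }
  have hmem : ∀ z : L₁ × L₂, z ∈ B₁.comap p₁ ⊓ B₂.comap p₂ ↔ z.1 ∈ B₁ ∧ z.2 ∈ B₂ := fun z => by
    rw [LieSubmodule.mem_inf, LieIdeal.mem_comap, LieIdeal.mem_comap]
    rfl
  refine ⟨B₁.comap p₁ ⊓ B₂.comap p₂, hmem, fun x hx y hy => ?_, fun a ha z hz => ?_⟩
  · obtain ⟨hy₁, hy₂⟩ := (hmem y).1 hy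
    refine Prod.ext (hB₁ x.1 (fun w hw => ?_) y.1 hy₁) (hB₂ x.2 (fun w hw => ?_) y.2 hy₂)
    · exact congrArg Prod.fst (hx (w, 0) ((hmem _).2 ⟨hw, B₂.zero_mem⟩))
    · exact congrArg Prod.snd (hx (0, w) ((hmem _).2 ⟨B₁.zero_mem, hw⟩))
  · have h₁ : StarStarProp (a.map p₁) := ha.map p₁ (fun x => (x, 0)) (fun _ => rfl) rfl
      fun x y => Prod.ext rfl (zero_lie y.2)
    have h₂ : StarStarProp (a.map p₂) := ha.map p₂ (fun x => (0, x)) (fun _ => rfl) rfl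
      fun x y => Prod.ext (zero_lie y.1) rfl
    exact (hmem z).2 ⟨hB₁max _ h₁ (LieIdeal.mem_map hz), hB₂max _ h₂ (LieIdeal.mem_map hz)⟩
end

section
/- Let n ≥ 3 and let Φ, Φ⁺, θ be the root system, positive system and highest root of type Bₙ. Let Ψ ⊆ Φ⁺ be a subset with θ ∈ Ψ and Ψ ≠ {θ}. Then there exists α ∈ Φ⁺ such that 2α + β ∉ Φ for every β ∈ Ψ, and α + γ ∈ Φ⁺ for some γ ∈ Ψ. -/
/-- The standard basis vector `e i` in `Fin n → ℤ`. -/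
def eB (n : ℕ) (i : Fin n) : Fin n → ℤ := Pi.single i 1

/-- The root system of type `Bₙ`. -/
def PhiB (n : ℕ) : Set (Fin n → ℤ) :=
  {v | (∃ i j : Fin n, ∃ ε δ : ℤ, i ≠ j ∧ (ε = 1 ∨ ε = -1) ∧ (δ = 1 ∨ δ = -1) ∧
    v = ε • eB n i + δ • eB n j) ∨ (∃ k : Fin n, v = eB n k ∨ v = -eB n k)}

/-- The positive system of type `Bₙ`. -/
def PhiPosB (n : ℕ) : Set (Fin n → ℤ) :=
  {v | (∃ i j : Fin n, i < j ∧ v = eB n i - eB n j) ∨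
    (∃ k : Fin n, v = eB n k) ∨
    (∃ i j : Fin n, i ≠ j ∧ v = eB n i + eB n j)}

theorem eB_apply (n : ℕ) (i k : Fin n) : eB n i k = if k = i then 1 else 0 :=
  Pi.single_apply i 1 k

theorem abs_apply_le_one_of_mem_PhiB {n : ℕ} {v : Fin n → ℤ} (hv : v ∈ PhiB n) (k : Fin n) :
    |v k| ≤ 1 := by
  rw [abs_le]
  rcases hv with ⟨i, j, ε, δ, hij, hε, hδ, rfl⟩ | ⟨i, rfl | rfl⟩
  · rcases hε with rfl | rfl <;> rcases hδ with rfl | rfl <;>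
      simp only [Pi.add_apply, Pi.smul_apply, eB_apply, smul_eq_mul] <;> grind
  all_goals simp only [Pi.neg_apply, eB_apply]; grind

theorem exists_eq_sub_of_mem_PhiPosB {n : ℕ} {v : Fin n → ℤ} (hv : v ∈ PhiPosB n) {k : Fin n}
    (hk : v k < 0) : ∃ i < k, v = eB n i - eB n k := by
  rcases hv with ⟨i, j, hij, rfl⟩ | ⟨i, rfl⟩ | ⟨i, j, hij, rfl⟩
  · obtain rfl : k = j := by
      simp only [Pi.sub_apply, eB_apply] at hk
      grind
    exact ⟨i, hij, rfl⟩
  · simp only [eB_apply] at hk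
    grind
  · simp only [Pi.add_apply, eB_apply] at hk
    grind

theorem two_smul_add_apply_bounds {n : ℕ} {α β : Fin n → ℤ} (h : (2 : ℤ) • α + β ∈ PhiB n)
    (k : Fin n) : -1 ≤ 2 * α k + β k ∧ 2 * α k + β k ≤ 1 := by
  simpa [abs_le] using abs_apply_le_one_of_mem_PhiB h k

theorem two_smul_sub_add_notMem_PhiB {n : ℕ} {i j : Fin n} (hij : i < j) {β : Fin n → ℤ}
    (hβ : β ∈ PhiPosB n) : (2 : ℤ) • (eB n i - eB n j) + β ∉ PhiB n := by
  intro h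
  have hi := two_smul_add_apply_bounds h i
  have hj := two_smul_add_apply_bounds h j
  simp only [Pi.sub_apply, eB_apply] at hi hj
  obtain ⟨a, ha, rfl⟩ := exists_eq_sub_of_mem_PhiPosB hβ (k := i) (by grind)
  simp only [Pi.sub_apply, eB_apply] at hi hj
  grind

theorem two_smul_add_add_notMem_PhiB {n : ℕ} {i j : Fin n} (hij : i ≠ j) {β : Fin n → ℤ}
    (hβ : β ∈ PhiPosB n) : (2 : ℤ) • (eB n i + eB n j) + β ∉ PhiB n := by
  intro h
  have hi := two_smul_add_apply_bounds h i
  have hj := two_smul_add_apply_bounds h j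
  simp only [Pi.add_apply, eB_apply] at hi hj
  obtain ⟨a, ha, rfl⟩ := exists_eq_sub_of_mem_PhiPosB hβ (k := i) (by grind)
  simp only [Pi.sub_apply, eB_apply] at hi hj
  grind

theorem typeB_eliminating (n : ℕ) (hn : 3 ≤ n) (Ψ : Set (Fin n → ℤ))
    (hΨ : Ψ ⊆ PhiPosB n)
    (hθmem : eB n ⟨0, by omega⟩ + eB n ⟨1, by omega⟩ ∈ Ψ)
    (hΨne : Ψ ≠ {eB n ⟨0, by omega⟩ + eB n ⟨1, by omega⟩}) :
    ∃ α ∈ PhiPosB n, (∀ β ∈ Ψ, (2 : ℤ) • α + β ∉ PhiB n) ∧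
      ∃ γ ∈ Ψ, α + γ ∈ PhiPosB n := by
  by_cases hdiff : ∃ i j : Fin n, i < j ∧ eB n i - eB n j ∈ Ψ
  · obtain ⟨i, j, hij, hmem⟩ := hdiff
    obtain ⟨l, hli, hlj⟩ : ∃ l : Fin n, l ≠ i ∧ l ≠ j :=
      Fin.exists_ne_and_ne_of_two_lt i j hn
    exact ⟨eB n j + eB n l, .inr (.inr ⟨j, l, hlj.symm, rfl⟩),
      fun β hβ ↦ two_smul_add_add_notMem_PhiB hlj.symm (hΨ hβ),
      _, hmem, .inr (.inr ⟨i, l, hli.symm, by abel⟩)⟩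
  have of_sum : ∀ k l m : Fin n, m < k → m ≠ l → eB n k + eB n l ∈ Ψ →
      ∃ α ∈ PhiPosB n, (∀ β ∈ Ψ, (2 : ℤ) • α + β ∉ PhiB n) ∧
        ∃ γ ∈ Ψ, α + γ ∈ PhiPosB n := fun k l m hmk hml hmem ↦
    ⟨eB n m - eB n k, .inl ⟨m, k, hmk, rfl⟩,
      fun β hβ ↦ two_smul_sub_add_notMem_PhiB hmk (hΨ hβ),
      _, hmem, .inr (.inr ⟨m, l, hml, by abel⟩)⟩
  obtain ⟨γ, hγ, hne⟩ : ∃ γ ∈ Ψ, γ ≠ eB n ⟨0, by omega⟩ + eB n ⟨1, by omega⟩ := by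
    by_contra! h
    exact hΨne (Set.eq_singleton_iff_unique_mem.2 ⟨hθmem, h⟩)
  rcases hΨ hγ with ⟨i, j, hij, rfl⟩ | ⟨k, rfl⟩ | ⟨i, j, hij, rfl⟩
  · exact absurd ⟨i, j, hij, hγ⟩ hdiff
  · by_cases hk : k = ⟨0, by omega⟩
    · subst hk
      refine ⟨eB n ⟨1, by omega⟩, .inr (.inl ⟨_, rfl⟩), fun β hβ h ↦ hdiff ?_,
        _, hγ, .inr (.inr ⟨_, _, by simp, rfl⟩)⟩
      have h1 := two_smul_add_apply_bounds h ⟨1, by omega⟩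
      simp only [eB_apply, if_true] at h1
      obtain ⟨a, ha, hβa⟩ := exists_eq_sub_of_mem_PhiPosB (hΨ hβ) (k := ⟨1, by omega⟩) (by omega)
      exact ⟨a, _, ha, hβa ▸ hβ⟩
    · have hk : (⟨0, by omega⟩ : Fin n) < k := by grind
      exact ⟨eB n ⟨0, by omega⟩ - eB n k, .inl ⟨_, k, hk, rfl⟩,
        fun β hβ ↦ two_smul_sub_add_notMem_PhiB hk (hΨ hβ),
        _, hγ, .inr (.inl ⟨⟨0, by omega⟩, by abel⟩)⟩
  · wlog hlt : j < i generalizing i j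
    · exact this j i hij.symm (by rwa [add_comm]) (by rwa [add_comm]) (by omega)
    by_cases hj : j = ⟨0, by omega⟩
    · refine of_sum i j ⟨1, by omega⟩ ?_ (by simp [hj]) hγ
      have hi : i ≠ ⟨1, by omega⟩ := by
        intro hi
        exact hne (by rw [hi, hj, add_comm])
      grind
    · exact of_sum i j ⟨0, by omega⟩ (by grind) (Ne.symm hj) hγ
end

section
/- Let Φ, Φ⁺, θ be the root system, positive system and highest root of type G₂. Let Ψ ⊆ Φ⁺ be a subset with θ ∈ Ψ and Ψ ≠ {θ}. Then there exists α ∈ Φ⁺ such that 2α + β ∉ Φ for every β ∈ Ψ, and α + γ ∈ Φ⁺ for some γ ∈ Ψ. -/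
/-- The positive system of type `G₂`, where `δ = (1,0)` and `ε = (0,1)`:
`Φ⁺ = {δ, ε, δ+ε, 2δ+ε, 3δ+ε, 3δ+2ε}`. -/
def PhiPosG2 : Set (ℤ × ℤ) :=
  {(1, 0), (0, 1), (1, 1), (2, 1), (3, 1), (3, 2)}

/-- The root system of type `G₂`. -/
def PhiG2 : Set (ℤ × ℤ) := PhiPosG2 ∪ (-PhiPosG2)

/-- The highest root of type `G₂`, namely `θ = 3δ + 2ε`. -/
def thetaG2 : ℤ × ℤ := (3, 2)

theorem mem_PhiPosG2_iff {x : ℤ × ℤ} :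
    x ∈ PhiPosG2 ↔ x = (1, 0) ∨ x = (0, 1) ∨ x = (1, 1) ∨ x = (2, 1) ∨ x = (3, 1) ∨ x = (3, 2) := by
  simp [PhiPosG2]

theorem mem_PhiG2_iff {x : ℤ × ℤ} : x ∈ PhiG2 ↔ x ∈ PhiPosG2 ∨ -x ∈ PhiPosG2 := Iff.rfl

/-- For `α ∈ {ε, 2δ+ε, 3δ+ε}` no `2α + β` with `β` positive is a root. -/
theorem two_smul_add_notMem_PhiG2 {α β : ℤ × ℤ}
    (hα : α = (0, 1) ∨ α = (2, 1) ∨ α = (3, 1)) (hβ : β ∈ PhiPosG2) :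
    (2 : ℤ) • α + β ∉ PhiG2 := by
  rw [mem_PhiPosG2_iff] at hβ
  rw [mem_PhiG2_iff, mem_PhiPosG2_iff, mem_PhiPosG2_iff]
  rcases hα with rfl | rfl | rfl <;> rcases hβ with rfl | rfl | rfl | rfl | rfl | rfl <;> decide

/-- The only positive root `β` for which `2(δ+ε) + β` is a root is `δ`. -/
theorem two_smul_one_one_add_notMem_PhiG2 {β : ℤ × ℤ} (hβ : β ∈ PhiPosG2) (h : β ≠ (1, 0)) :
    (2 : ℤ) • ((1, 1) : ℤ × ℤ) + β ∉ PhiG2 := by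
  rw [mem_PhiPosG2_iff] at hβ
  rw [mem_PhiG2_iff, mem_PhiPosG2_iff, mem_PhiPosG2_iff]
  rcases hβ with rfl | rfl | rfl | rfl | rfl | rfl
  · exact absurd rfl h
  all_goals decide

theorem typeG2_eliminating (Ψ : Set (ℤ × ℤ)) (hΨ : Ψ ⊆ PhiPosG2)
    (hθmem : thetaG2 ∈ Ψ) (hΨne : Ψ ≠ {thetaG2}) :
    ∃ α ∈ PhiPosG2, (∀ β ∈ Ψ, (2 : ℤ) • α + β ∉ PhiG2) ∧
      ∃ γ ∈ Ψ, α + γ ∈ PhiPosG2 := by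
  obtain ⟨γ, hγ, hne⟩ : ∃ γ ∈ Ψ, γ ≠ thetaG2 := by
    by_contra! h
    exact hΨne (Set.eq_singleton_iff_unique_mem.2 ⟨hθmem, h⟩)
  have key (α γ : ℤ × ℤ) (hα : α = (0, 1) ∨ α = (2, 1) ∨ α = (3, 1)) (hγ : γ ∈ Ψ)
      (hsum : α + γ ∈ PhiPosG2) :
      ∃ α ∈ PhiPosG2, (∀ β ∈ Ψ, (2 : ℤ) • α + β ∉ PhiG2) ∧ ∃ γ ∈ Ψ, α + γ ∈ PhiPosG2 :=
    ⟨α, mem_PhiPosG2_iff.2 (by tauto),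
      fun _ hβ => two_smul_add_notMem_PhiG2 hα (hΨ hβ), γ, hγ, hsum⟩
  by_cases hδ : ((1, 0) : ℤ × ℤ) ∈ Ψ
  · exact key (0, 1) (1, 0) (by decide) hδ (by simp [PhiPosG2])
  rcases mem_PhiPosG2_iff.1 (hΨ hγ) with rfl | rfl | rfl | rfl | rfl | rfl
  · exact absurd hγ hδ
  · exact key (3, 1) _ (by decide) hγ (by simp [PhiPosG2])
  · exact key (2, 1) _ (by decide) hγ (by simp [PhiPosG2])
  · exact ⟨(1, 1), by simp [PhiPosG2],
      fun β hβ => two_smul_one_one_add_notMem_PhiG2 (hΨ hβ) (ne_of_mem_of_not_mem hβ hδ),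
      _, hγ, by simp [PhiPosG2]⟩
  · exact key (0, 1) _ (by decide) hγ (by simp [PhiPosG2])
  · exact absurd rfl hne
end

section
/- Let n ≥ 3, let Φ and Φ⁺ be the root system and positive system of type Aₙ with highest root θ := e_0 − e_n, and define 𝒵 := {β ∈ Φ⁺ : for every α ∈ Φ⁺, if α + β ∈ Φ then α + β = θ}. Then 𝒵 = {e_0 − e_n, e_0 − e_{n−1}, e_1 − e_n}, and for all β, γ ∈ 𝒵 the vector β + γ does not lie in Φ. -/
/-- The standard basis vector `e i` in `Fin (n+1) → ℤ`. -/
def eA (n : ℕ) (i : Fin (n + 1)) : Fin (n + 1) → ℤ := Pi.single i 1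

/-- The root system of type `Aₙ`. -/
def PhiA (n : ℕ) : Set (Fin (n + 1) → ℤ) :=
  {v | ∃ i j : Fin (n + 1), i ≠ j ∧ v = eA n i - eA n j}

/-- The positive system of type `Aₙ`. -/
def PhiPosA (n : ℕ) : Set (Fin (n + 1) → ℤ) :=
  {v | ∃ i j : Fin (n + 1), i < j ∧ v = eA n i - eA n j}

theorem eA_apply (n : ℕ) (i k : Fin (n + 1)) : eA n i k = if k = i then 1 else 0 := by
  simp [eA, Pi.single_apply]

theorem eA_sub_eA_inj {n : ℕ} {a b c d : Fin (n + 1)} (hab : a ≠ b) :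
    eA n a - eA n b = eA n c - eA n d ↔ a = c ∧ b = d := by
  refine ⟨fun h => ?_, by rintro ⟨rfl, rfl⟩; rfl⟩
  have h₁ := congrFun h a
  have h₂ := congrFun h b
  simp only [Pi.sub_apply, eA_apply] at h₁ h₂
  grind

/-- Two roots whose sum is a root are composable as pairs of indices. -/
theorem eq_or_eq_of_add_mem_PhiA {n : ℕ} {a b i j : Fin (n + 1)} (hab : a ≠ b) (hij : i ≠ j)
    (h : (eA n a - eA n b) + (eA n i - eA n j) ∈ PhiA n) : b = i ∨ a = j := by
  obtain ⟨c, d, -, h⟩ := h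
  have h₁ := congrFun h a
  have h₂ := congrFun h i
  simp only [Pi.sub_apply, Pi.add_apply, eA_apply] at h₁ h₂
  grind

/-- The condition defining `𝒵`, in terms of the indices of a positive root. -/
theorem forall_add_eq_iff {n : ℕ} {i j p q : Fin (n + 1)} (hij : i < j) :
    (∀ α ∈ PhiPosA n, α + (eA n i - eA n j) ∈ PhiA n →
        α + (eA n i - eA n j) = eA n p - eA n q) ↔
      (∀ a < i, a = p ∧ j = q) ∧ ∀ b > j, i = p ∧ b = q := by
  constructor
  · refine fun h => ⟨fun a ha => ?_, fun b hb => ?_⟩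
    · have hne : a ≠ j := (ha.trans hij).ne
      have hsum : (eA n a - eA n i) + (eA n i - eA n j) = eA n a - eA n j := by abel
      have := h _ ⟨a, i, ha, rfl⟩ ⟨a, j, hne, hsum⟩
      rwa [hsum, eA_sub_eA_inj hne] at this
    · have hne : i ≠ b := (hij.trans hb).ne
      have hsum : (eA n j - eA n b) + (eA n i - eA n j) = eA n i - eA n b := by abel
      have := h _ ⟨j, b, hb, rfl⟩ ⟨i, b, hne, hsum⟩
      rwa [hsum, eA_sub_eA_inj hne] at this
  · rintro ⟨h₁, h₂⟩ _ ⟨a, b, hab, rfl⟩ h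
    rcases eq_or_eq_of_add_mem_PhiA hab.ne hij.ne h with rfl | rfl
    · obtain ⟨rfl, rfl⟩ := h₁ a hab
      abel
    · obtain ⟨rfl, rfl⟩ := h₂ b hab
      abel

theorem typeA_Zcal (n : ℕ) (hn : 3 ≤ n) :
    {β ∈ PhiPosA n | ∀ α ∈ PhiPosA n, α + β ∈ PhiA n → α + β =
        eA n ⟨0, by omega⟩ - eA n ⟨n, by omega⟩} =
      {eA n ⟨0, by omega⟩ - eA n ⟨n, by omega⟩,
       eA n ⟨0, by omega⟩ - eA n ⟨n - 1, by omega⟩,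
       eA n ⟨1, by omega⟩ - eA n ⟨n, by omega⟩} ∧
    ∀ β ∈ {β ∈ PhiPosA n | ∀ α ∈ PhiPosA n, α + β ∈ PhiA n → α + β =
        eA n ⟨0, by omega⟩ - eA n ⟨n, by omega⟩},
      ∀ γ ∈ {β ∈ PhiPosA n | ∀ α ∈ PhiPosA n, α + β ∈ PhiA n → α + β =
        eA n ⟨0, by omega⟩ - eA n ⟨n, by omega⟩},
      β + γ ∉ PhiA n := by
  have hZ : {β ∈ PhiPosA n | ∀ α ∈ PhiPosA n, α + β ∈ PhiA n → α + β =
        eA n ⟨0, by omega⟩ - eA n ⟨n, by omega⟩} =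
      {eA n ⟨0, by omega⟩ - eA n ⟨n, by omega⟩,
       eA n ⟨0, by omega⟩ - eA n ⟨n - 1, by omega⟩,
       eA n ⟨1, by omega⟩ - eA n ⟨n, by omega⟩} := by
    ext β
    simp only [Set.mem_ofPred_eq, Set.mem_insert_iff, Set.mem_singleton_iff]
    constructor
    · rintro ⟨⟨i, j, hij, rfl⟩, h⟩
      rw [forall_add_eq_iff hij] at h
      rw [eA_sub_eA_inj hij.ne, eA_sub_eA_inj hij.ne, eA_sub_eA_inj hij.ne]
      obtain ⟨h₁, h₂⟩ := h
      have h₃ := h₁ ⟨0, by omega⟩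
      have h₄ := h₁ ⟨1, by omega⟩
      have h₅ := h₂ ⟨n, by omega⟩
      have h₆ := h₂ ⟨n - 1, by omega⟩
      simp only [Fin.lt_def, gt_iff_lt, Fin.ext_iff] at *
      omega
    · have key : ∀ i j : Fin (n + 1), i < j →
          ((∀ a < i, a = ⟨0, by omega⟩ ∧ j = ⟨n, by omega⟩) ∧
            ∀ b > j, i = ⟨0, by omega⟩ ∧ b = ⟨n, by omega⟩) →
          eA n i - eA n j ∈ PhiPosA n ∧ ∀ α ∈ PhiPosA n, α + (eA n i - eA n j) ∈ PhiA n →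
            α + (eA n i - eA n j) = eA n ⟨0, by omega⟩ - eA n ⟨n, by omega⟩ :=
        fun i j hij h => ⟨⟨i, j, hij, rfl⟩, (forall_add_eq_iff hij).2 h⟩
      rintro (rfl | rfl | rfl) <;>
        refine key _ _ ?_ ⟨fun a ha => ?_, fun b hb => ?_⟩ <;>
        simp only [Fin.lt_def, gt_iff_lt, Fin.ext_iff, true_and, and_true] at * <;> omega
  refine ⟨hZ, ?_⟩
  rw [hZ]
  rintro β (rfl | rfl | rfl) γ (rfl | rfl | rfl) h <;>
    have := eq_or_eq_of_add_mem_PhiA (by simp only [ne_eq, Fin.ext_iff]; omega)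
      (by simp only [ne_eq, Fin.ext_iff]; omega) h <;>
    simp only [Fin.ext_iff] at this <;> omega
end

section
/- Let n ≥ 3, let Φ and Φ⁺ be the root system and positive system of type Bₙ with highest root θ := e_1 + e_2, and define 𝒵 := {β ∈ Φ⁺ : for every α ∈ Φ⁺, if α + β ∈ Φ then α + β = θ}. Then 𝒵 = {e_1 + e_2, e_1 + e_3}, and for all β, γ ∈ 𝒵 the vector β + γ does not lie in Φ. -/
/-- Every coordinate of a root is at most `1`. -/
theorem PhiB.apply_le_one {n : ℕ} {v : Fin n → ℤ} (hv : v ∈ PhiB n) (a : Fin n) : v a ≤ 1 := by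
  rcases hv with ⟨i, j, ε, δ, hij, hε, hδ, rfl⟩ | ⟨k, rfl | rfl⟩
  · simp only [Pi.add_apply, Pi.smul_apply, eB_apply, smul_eq_mul]
    rcases hε with rfl | rfl <;> rcases hδ with rfl | rfl <;> grind
  · rw [eB_apply]; grind
  · rw [Pi.neg_apply, eB_apply]; grind

/-- Three distinct coordinates of a root add up to at most `2`. -/
theorem PhiB.add_add_le_two {n : ℕ} {v : Fin n → ℤ} (hv : v ∈ PhiB n) {a b c : Fin n}
    (hab : a ≠ b) (hac : a ≠ c) (hbc : b ≠ c) : v a + v b + v c ≤ 2 := by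
  rcases hv with ⟨i, j, ε, δ, hij, hε, hδ, rfl⟩ | ⟨k, rfl | rfl⟩
  · simp only [Pi.add_apply, Pi.smul_apply, eB_apply, smul_eq_mul]
    rcases hε with rfl | rfl <;> rcases hδ with rfl | rfl <;> grind
  · simp only [eB_apply]; grind
  · simp only [Pi.neg_apply, eB_apply]; grind

theorem eB_add_eB_mem_PhiB {n : ℕ} {i j : Fin n} (h : i ≠ j) : eB n i + eB n j ∈ PhiB n :=
  Or.inl ⟨i, j, 1, 1, h, Or.inl rfl, Or.inl rfl, by simp⟩

theorem eB_mem_PhiB {n : ℕ} (k : Fin n) : eB n k ∈ PhiB n := Or.inr ⟨k, Or.inl rfl⟩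

theorem eB_sub_eB_mem_PhiPosB {n : ℕ} {i j : Fin n} (h : i < j) : eB n i - eB n j ∈ PhiPosB n :=
  Or.inl ⟨i, j, h, rfl⟩

theorem eB_mem_PhiPosB {n : ℕ} (k : Fin n) : eB n k ∈ PhiPosB n := Or.inr (Or.inl ⟨k, rfl⟩)

theorem eB_add_eB_mem_PhiPosB {n : ℕ} {i j : Fin n} (h : i ≠ j) :
    eB n i + eB n j ∈ PhiPosB n :=
  Or.inr (Or.inr ⟨i, j, h, rfl⟩)

theorem eB_ne_eB_add_eB {n : ℕ} (k : Fin n) {a b : Fin n} (hab : a ≠ b) :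
    eB n k ≠ eB n a + eB n b := by
  intro h
  have ha := congrFun h a
  have hb := congrFun h b
  simp only [Pi.add_apply, eB_apply] at ha hb
  grind

theorem eq_or_eq_of_eB_add_eB_eq {n : ℕ} {i j a b : Fin n} (h : eB n i + eB n j = eB n a + eB n b) :
    i = a ∧ j = b ∨ i = b ∧ j = a := by
  have hi := congrFun h i
  have hj := congrFun h j
  have ha := congrFun h a
  have hb := congrFun h b
  simp only [Pi.add_apply, eB_apply] at hi hj ha hb
  grind

/-- A vector with a positive `i`-th coordinate and nonnegative `a`-th and `b`-th coordinates
cannot be added to the root `e a + e b`. -/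
theorem add_eB_add_eB_notMem_PhiB {n : ℕ} {v : Fin n → ℤ} {i a b : Fin n} (hab : a ≠ b)
    (hi : 1 ≤ v i) (ha : 0 ≤ v a) (hb : 0 ≤ v b) : v + (eB n a + eB n b) ∉ PhiB n := by
  intro h
  have h1 := PhiB.apply_le_one h i
  have h2 := fun hia hib => PhiB.add_add_le_two h (a := i) (b := a) (c := b) hia hib hab
  simp only [Pi.add_apply, eB_apply] at h1 h2
  grind

/-- A positive root that can be added to `e a + e b` is of the form `e i - e j` with `i ≠ a, b`
and `j ∈ {a, b}`. -/
theorem exists_sub_of_add_mem_PhiB {n : ℕ} {α : Fin n → ℤ} {a b : Fin n} (hab : a ≠ b)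
    (hα : α ∈ PhiPosB n) (h : α + (eB n a + eB n b) ∈ PhiB n) :
    ∃ i j : Fin n, i < j ∧ i ≠ a ∧ i ≠ b ∧ (j = a ∨ j = b) ∧ α = eB n i - eB n j := by
  rcases hα with ⟨i, j, hij, rfl⟩ | ⟨k, rfl⟩ | ⟨i, j, hij, rfl⟩
  · have h1 := PhiB.apply_le_one h i
    have h2 := fun hia hib => PhiB.add_add_le_two h (a := i) (b := a) (c := b) hia hib hab
    simp only [Pi.add_apply, Pi.sub_apply, eB_apply] at h1 h2
    refine ⟨i, j, hij, ?_, ?_, ?_, rfl⟩ <;> grind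
  · refine absurd h (add_eB_add_eB_notMem_PhiB (i := k) hab ?_ ?_ ?_) <;>
      simp only [eB_apply] <;> grind
  · refine absurd h (add_eB_add_eB_notMem_PhiB (i := i) hab ?_ ?_ ?_) <;>
      simp only [Pi.add_apply, eB_apply] <;> grind

/-- If `i < j` and adding a positive root to `e i + e j` yields no root other than `e 0 + e 1`,
then `i = 0` and `j` is `1` or `2`. -/
theorem eq_zero_and_le_two_of_forall_add {n : ℕ} {z o t i j : Fin n} (hz : z.val = 0)
    (ho : o.val = 1) (ht : t.val = 2) (hij : i < j)
    (h : ∀ α ∈ PhiPosB n, α + (eB n i + eB n j) ∈ PhiB n →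
      α + (eB n i + eB n j) = eB n z + eB n o) :
    i = z ∧ (j = o ∨ j = t) := by
  have hiz : i = z := by
    by_contra hne
    have hzi : z < i := by grind
    have e : eB n z - eB n i + (eB n i + eB n j) = eB n z + eB n j := by abel
    have := h _ (eB_sub_eB_mem_PhiPosB hzi) (e ▸ eB_add_eB_mem_PhiB (hzi.trans hij).ne)
    rw [e] at this
    have := eq_or_eq_of_eB_add_eB_eq this
    grind
  refine ⟨hiz, ?_⟩
  by_contra hne
  have htj : t < j := by grind
  have hit : i ≠ t := by grind
  have e : eB n t - eB n j + (eB n i + eB n j) = eB n i + eB n t := by abel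
  have := h _ (eB_sub_eB_mem_PhiPosB htj) (e ▸ eB_add_eB_mem_PhiB hit)
  rw [e] at this
  have := eq_or_eq_of_eB_add_eB_eq this
  grind

theorem Zcal_eq {n : ℕ} {z o t : Fin n} (hz : z.val = 0) (ho : o.val = 1) (ht : t.val = 2) :
    {β ∈ PhiPosB n | ∀ α ∈ PhiPosB n, α + β ∈ PhiB n → α + β = eB n z + eB n o} =
      {eB n z + eB n o, eB n z + eB n t} := by
  have hzo : z ≠ o := by grind
  have hzt : z ≠ t := by grind
  have hot : o ≠ t := by grind
  ext β
  simp only [Set.mem_ofPred_eq, Set.mem_insert_iff, Set.mem_singleton_iff]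
  constructor
  · rintro ⟨⟨i, j, hij, rfl⟩ | ⟨k, rfl⟩ | ⟨i, j, hij, rfl⟩, h⟩
    · have e : eB n j + (eB n i - eB n j) = eB n i := by abel
      have := h _ (eB_mem_PhiPosB j) (e.symm ▸ eB_mem_PhiB i)
      exact absurd (e ▸ this) (eB_ne_eB_add_eB i hzo)
    · obtain ⟨l, hlk, hl⟩ : ∃ l : Fin n, l ≠ k ∧ (l = t ∨ k = t) := by
        by_cases hk : k = t
        · exact ⟨z, hk ▸ hzt, Or.inr hk⟩
        · exact ⟨t, Ne.symm hk, Or.inl rfl⟩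
      have := eq_or_eq_of_eB_add_eB_eq (h _ (eB_mem_PhiPosB l) (eB_add_eB_mem_PhiB hlk))
      grind
    · rcases lt_or_gt_of_ne hij with hlt | hlt
      · obtain ⟨rfl, rfl | rfl⟩ := eq_zero_and_le_two_of_forall_add hz ho ht hlt h <;> simp
      · rw [add_comm (eB n i)] at h ⊢
        obtain ⟨rfl, rfl | rfl⟩ := eq_zero_and_le_two_of_forall_add hz ho ht hlt h <;> simp
  · rintro (rfl | rfl)
    · refine ⟨eB_add_eB_mem_PhiPosB hzo, fun α hα h => ?_⟩
      obtain ⟨i, j, hij, hiz, -, hj, -⟩ := exists_sub_of_add_mem_PhiB hzo hα h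
      grind
    · refine ⟨eB_add_eB_mem_PhiPosB hzt, fun α hα h => ?_⟩
      obtain ⟨i, j, hij, hiz, hit, hj, rfl⟩ := exists_sub_of_add_mem_PhiB hzt hα h
      obtain rfl : j = t := by grind
      obtain rfl : i = o := by grind
      abel

theorem typeB_Zcal (n : ℕ) (hn : 3 ≤ n) :
    {β ∈ PhiPosB n | ∀ α ∈ PhiPosB n, α + β ∈ PhiB n → α + β =
        eB n ⟨0, by omega⟩ + eB n ⟨1, by omega⟩} =
      {eB n ⟨0, by omega⟩ + eB n ⟨1, by omega⟩,
       eB n ⟨0, by omega⟩ + eB n ⟨2, by omega⟩} ∧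
    ∀ β ∈ {β ∈ PhiPosB n | ∀ α ∈ PhiPosB n, α + β ∈ PhiB n → α + β =
        eB n ⟨0, by omega⟩ + eB n ⟨1, by omega⟩},
      ∀ γ ∈ {β ∈ PhiPosB n | ∀ α ∈ PhiPosB n, α + β ∈ PhiB n → α + β =
        eB n ⟨0, by omega⟩ + eB n ⟨1, by omega⟩},
      β + γ ∉ PhiB n := by
  rw [Zcal_eq (t := ⟨2, by omega⟩) rfl rfl rfl]
  refine ⟨rfl, fun β hβ γ hγ h => ?_⟩
  have h0 := PhiB.apply_le_one h ⟨0, by omega⟩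
  rcases hβ with rfl | rfl <;> rcases hγ with rfl | rfl <;> simp [eB_apply] at h0
end
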